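/- arXiv:2510.10768 — 3 statements merged into one kernel-verified Lean document; each statement's English description precedes it below -/
import Mathlib

section
/- The subgroup $\widehat{G} = \{M \in Sp(4,\mathbb{R}) \mid M\langle\Omega\rangle \in \widehat{\mathbb{H}}_2 \text{ for all } \Omega \in \widehat{\mathbb{H}}_2\}$ equals $\{M \in Sp(4,\mathbb{R}) \mid MQ = QM \text{ or } MQ = -QM\}$. -/
open Matrix Complex

noncomputable section

/-- `J₄ = [[0, I₂], [-I₂, 0]]`. -/
def J4 : Matrix (Fin 4) (Fin 4) ℝ :=
  !![0,0,1,0; 0,0,0,1; -1,0,0,0; 0,-1,0,0]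

/-- The symplectic group `Sp(4,ℝ)`. -/
def Sp4 : Set (Matrix (Fin 4) (Fin 4) ℝ) :=
  {M | IsUnit M.det ∧ Mᵀ * J4 * M = J4}

/-- `Q = [[q, 0], [0, q]]` with `q = [[0,1],[1,0]]`. -/
def QM : Matrix (Fin 4) (Fin 4) ℝ :=
  !![0,1,0,0; 1,0,0,0; 0,0,0,1; 0,0,1,0]

/-- Upper-left 2×2 block (complexified). -/
def blkA (M : Matrix (Fin 4) (Fin 4) ℝ) : Matrix (Fin 2) (Fin 2) ℂ :=
  Matrix.of fun i j => (M (Fin.castAdd 2 i) (Fin.castAdd 2 j) : ℂ)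

def blkB (M : Matrix (Fin 4) (Fin 4) ℝ) : Matrix (Fin 2) (Fin 2) ℂ :=
  Matrix.of fun i j => (M (Fin.castAdd 2 i) (Fin.natAdd 2 j) : ℂ)

def blkC (M : Matrix (Fin 4) (Fin 4) ℝ) : Matrix (Fin 2) (Fin 2) ℂ :=
  Matrix.of fun i j => (M (Fin.natAdd 2 i) (Fin.castAdd 2 j) : ℂ)

def blkD (M : Matrix (Fin 4) (Fin 4) ℝ) : Matrix (Fin 2) (Fin 2) ℂ :=
  Matrix.of fun i j => (M (Fin.natAdd 2 i) (Fin.natAdd 2 j) : ℂ)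

/-- The action `M⟨Ω⟩ = (AΩ + B)(CΩ + D)⁻¹`. -/
def act (M : Matrix (Fin 4) (Fin 4) ℝ) (Ω : Matrix (Fin 2) (Fin 2) ℂ) :
    Matrix (Fin 2) (Fin 2) ℂ :=
  (blkA M * Ω + blkB M) * (blkC M * Ω + blkD M)⁻¹

/-- The Siegel upper half plane of degree 2. -/
def H2 : Set (Matrix (Fin 2) (Fin 2) ℂ) :=
  {Ω | Ωᵀ = Ω ∧ (Matrix.of fun i j => (Ω i j).im : Matrix (Fin 2) (Fin 2) ℝ).PosDef}

/-- The new kind Siegel upper half space `Ĥ₂ = {Ω ∈ H₂ | Q⟨Ω⟩ = Ω}`. -/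
def HHat2 : Set (Matrix (Fin 2) (Fin 2) ℂ) :=
  {Ω | Ω ∈ H2 ∧ act QM Ω = Ω}

/-- `Ĝ = {M ∈ Sp(4,ℝ) | M⟨Ω⟩ ∈ Ĥ₂ for all Ω ∈ Ĥ₂}`. -/
def GHat : Set (Matrix (Fin 4) (Fin 4) ℝ) :=
  {M | M ∈ Sp4 ∧ ∀ Ω ∈ HHat2, act M Ω ∈ HHat2}

/-- The swap matrix `q = [[0,1],[1,0]]` over `ℂ`. -/
def swapC : Matrix (Fin 2) (Fin 2) ℂ := !![0, 1; 1, 0]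

lemma swapC_mul_self : swapC * swapC = 1 := by
  ext i j; fin_cases i <;> fin_cases j <;> simp [swapC, Matrix.mul_apply]

lemma swapC_inv : swapC⁻¹ = swapC := Matrix.inv_eq_left_inv swapC_mul_self

lemma act_QM (Ω : Matrix (Fin 2) (Fin 2) ℂ) : act QM Ω = swapC * Ω * swapC := by
  have hA : blkA QM = swapC := by
    ext i j; fin_cases i <;> fin_cases j <;> simp [blkA, QM, swapC]
  have hB : blkB QM = 0 := by
    ext i j; fin_cases i <;> fin_cases j <;> simp [blkB, QM]
  have hC : blkC QM = 0 := by
    ext i j; fin_cases i <;> fin_cases j <;> simp [blkC, QM]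
  have hD : blkD QM = swapC := by
    ext i j; fin_cases i <;> fin_cases j <;> simp [blkD, QM, swapC]
  rw [act, hA, hB, hC, hD, zero_mul, add_zero, zero_add, swapC_inv]

lemma act_QM_eq_iff (Ω : Matrix (Fin 2) (Fin 2) ℂ) :
    act QM Ω = Ω ↔ swapC * Ω = Ω * swapC := by
  rw [act_QM]
  constructor
  · intro h
    calc swapC * Ω = swapC * Ω * swapC * swapC := by
          rw [mul_assoc _ swapC, swapC_mul_self, mul_one]
      _ = Ω * swapC := by rw [h]
  · intro h
    rw [h, mul_assoc, swapC_mul_self, mul_one]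

/-- The entrywise imaginary part of a matrix. -/
def imPart (Ω : Matrix (Fin 2) (Fin 2) ℂ) : Matrix (Fin 2) (Fin 2) ℝ :=
  Matrix.of fun i j => (Ω i j).im

lemma sub_conjTranspose_of_symm {Ω : Matrix (Fin 2) (Fin 2) ℂ} (h : Ωᵀ = Ω) :
    Ω - Ωᴴ = (2 * I) • (imPart Ω).map ((↑) : ℝ → ℂ) := by
  ext i j
  have hij : Ω j i = Ω i j := congrFun (congrFun h i) j
  simp only [Matrix.sub_apply, Matrix.conjTranspose_apply, Matrix.smul_apply, Matrix.map_apply,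
    imPart, Matrix.of_apply, hij, smul_eq_mul]
  apply Complex.ext <;> simp
  ring

open scoped ComplexOrder in
lemma posDef_map_ofReal {n : Type*} [Fintype n] {Y : Matrix n n ℝ}
    (hY : Y.PosDef) : (Y.map ((↑) : ℝ → ℂ)).PosDef := by
  have hsymm (i j : n) : Y j i = Y i j := by simpa using hY.1.apply i j
  refine Matrix.PosDef.of_dotProduct_mulVec_pos ?_ fun x hx => ?_
  · ext i j
    simp [hsymm i j]
  · set a : n → ℝ := fun i => (x i).re
    set b : n → ℝ := fun i => (x i).im
    have hsum : star x ⬝ᵥ (Y.map ((↑) : ℝ → ℂ) *ᵥ x)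
        = ((a ⬝ᵥ (Y *ᵥ a) + b ⬝ᵥ (Y *ᵥ b) : ℝ) : ℂ) := by
      have hcross : a ⬝ᵥ (Y *ᵥ b) = b ⬝ᵥ (Y *ᵥ a) := by
        have hYt : Yᵀ = Y := by ext i j; exact hsymm i j
        rw [Matrix.dotProduct_mulVec, ← Matrix.mulVec_transpose, hYt, dotProduct_comm]
      apply Complex.ext
      · simp [dotProduct, Matrix.mulVec, a, b, Finset.sum_add_distrib]
      · rw [Complex.ofReal_im, ← sub_eq_zero.mpr hcross]
        simp [dotProduct, Matrix.mulVec, a, b, Finset.sum_add_distrib, sub_eq_add_neg]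
    rw [hsum, Complex.zero_lt_real]
    have hnonneg (v : n → ℝ) : 0 ≤ v ⬝ᵥ (Y *ᵥ v) := by
      simpa using hY.posSemidef.dotProduct_mulVec_nonneg v
    by_cases ha : a = 0
    · have hb : b ≠ 0 := fun hb =>
        hx (funext fun i => Complex.ext (congrFun ha i) (congrFun hb i))
      exact add_pos_of_nonneg_of_pos (hnonneg a) (by simpa using hY.dotProduct_mulVec_pos hb)
    · exact add_pos_of_pos_of_nonneg (by simpa using hY.dotProduct_mulVec_pos ha) (hnonneg b)

open scoped ComplexOrder in
lemma posDef_of_map_ofReal {n : Type*} [Fintype n] {Y : Matrix n n ℝ}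
    (hY : (Y.map ((↑) : ℝ → ℂ)).PosDef) : Y.PosDef := by
  refine Matrix.PosDef.of_dotProduct_mulVec_pos ?_ fun x hx => ?_
  · ext i j
    simpa using hY.1.apply i j
  · have hx' : (fun i => (x i : ℂ)) ≠ 0 := fun h =>
      hx (funext fun i => by simpa using congrFun h i)
    have := hY.dotProduct_mulVec_pos hx'
    rw [← Complex.zero_lt_real]
    convert this using 1
    simp [dotProduct, Matrix.mulVec]

lemma blk_relations {M : Matrix (Fin 4) (Fin 4) ℝ} (hM : Mᵀ * J4 * M = J4) :
    (blkA M)ᵀ * blkC M = (blkC M)ᵀ * blkA M ∧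
    (blkB M)ᵀ * blkD M = (blkD M)ᵀ * blkB M ∧
    (blkA M)ᵀ * blkD M - (blkC M)ᵀ * blkB M = 1 ∧
    (blkD M)ᵀ * blkA M - (blkB M)ᵀ * blkC M = 1 := by
  have h (i j : Fin 4) : M 0 i * M 2 j + M 1 i * M 3 j - M 2 i * M 0 j - M 3 i * M 1 j
      = J4 i j := by
    rw [← hM]
    simp [Matrix.mul_apply, Fin.sum_univ_four, J4]
    ring
  have hc (i j : Fin 4) : (M 0 i * M 2 j + M 1 i * M 3 j - M 2 i * M 0 j - M 3 i * M 1 j : ℂ)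
      = J4 i j := by
    rw [← h]; push_cast; ring
  refine ⟨?_, ?_, ?_, ?_⟩ <;> ext i j
  · have := hc (Fin.castAdd 2 i) (Fin.castAdd 2 j)
    fin_cases i <;> fin_cases j <;>
      simp [blkA, blkC, Matrix.mul_apply, Fin.sum_univ_two, J4] at this ⊢ <;> linear_combination this
  · have := hc (Fin.natAdd 2 i) (Fin.natAdd 2 j)
    fin_cases i <;> fin_cases j <;>
      simp [blkB, blkD, Matrix.mul_apply, Fin.sum_univ_two, J4] at this ⊢ <;> linear_combination this
  · have := hc (Fin.castAdd 2 i) (Fin.natAdd 2 j)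
    fin_cases i <;> fin_cases j <;>
      simp [blkA, blkB, blkC, blkD, Matrix.mul_apply, Fin.sum_univ_two, J4] at this ⊢ <;>
      linear_combination this
  · have := hc (Fin.natAdd 2 i) (Fin.castAdd 2 j)
    fin_cases i <;> fin_cases j <;>
      simp [blkA, blkB, blkC, blkD, Matrix.mul_apply, Fin.sum_univ_two, J4] at this ⊢ <;>
      linear_combination -this

lemma blk_conjTranspose (M : Matrix (Fin 4) (Fin 4) ℝ) :
    (blkA M)ᴴ = (blkA M)ᵀ ∧ (blkB M)ᴴ = (blkB M)ᵀ ∧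
    (blkC M)ᴴ = (blkC M)ᵀ ∧ (blkD M)ᴴ = (blkD M)ᵀ := by
  refine ⟨?_, ?_, ?_, ?_⟩ <;> ext i j <;> simp [blkA, blkB, blkC, blkD]

lemma denom_transpose_mul_num {M : Matrix (Fin 4) (Fin 4) ℝ} (hM : Mᵀ * J4 * M = J4)
    (Ω Ω' : Matrix (Fin 2) (Fin 2) ℂ) :
    (Ω' * (blkC M)ᵀ + (blkD M)ᵀ) * (blkA M * Ω + blkB M)
      - (Ω' * (blkA M)ᵀ + (blkB M)ᵀ) * (blkC M * Ω + blkD M) = Ω - Ω' := by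
  obtain ⟨h1, h2, h3, h4⟩ := blk_relations hM
  calc _ = Ω' * ((blkC M)ᵀ * blkA M - (blkA M)ᵀ * blkC M) * Ω
        + ((blkD M)ᵀ * blkB M - (blkB M)ᵀ * blkD M)
        + ((blkD M)ᵀ * blkA M - (blkB M)ᵀ * blkC M) * Ω
        - Ω' * ((blkA M)ᵀ * blkD M - (blkC M)ᵀ * blkB M) := by noncomm_ring
    _ = _ := by rw [h1, h2, h3, h4]; simp

open scoped ComplexOrder in
lemma isUnit_det_denom {M : Matrix (Fin 4) (Fin 4) ℝ} (hM : Mᵀ * J4 * M = J4)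
    {Ω : Matrix (Fin 2) (Fin 2) ℂ} (hΩ : Ω ∈ H2) : IsUnit (blkC M * Ω + blkD M).det := by
  obtain ⟨hA, hB, hC, hD⟩ := blk_conjTranspose M
  have key := denom_transpose_mul_num hM Ω Ωᴴ
  rw [← hA, ← hB, ← hC, ← hD, ← Matrix.conjTranspose_mul, ← Matrix.conjTranspose_mul,
    ← Matrix.conjTranspose_add, ← Matrix.conjTranspose_add, sub_conjTranspose_of_symm hΩ.1] at key
  rw [isUnit_iff_ne_zero]
  intro hdet
  obtain ⟨v, hv, hZv⟩ := Matrix.exists_mulVec_eq_zero_iff.mpr hdet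
  have hpos := (posDef_map_ofReal (Y := imPart Ω) hΩ.2).dotProduct_mulVec_pos hv
  have h0 : star v ⬝ᵥ (((2 * I) • (imPart Ω).map ((↑) : ℝ → ℂ)) *ᵥ v) = 0 := by
    rw [← key, Matrix.sub_mulVec, ← Matrix.mulVec_mulVec, ← Matrix.mulVec_mulVec, hZv,
      Matrix.mulVec_zero, sub_zero, Matrix.dotProduct_mulVec, ← Matrix.star_mulVec, hZv]
    simp
  rw [Matrix.smul_mulVec, dotProduct_smul, smul_eq_mul] at h0
  rcases mul_eq_zero.mp h0 with h | h
  · simp at h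
  · exact hpos.ne' h

open scoped ComplexOrder in
/-- The symplectic group preserves the Siegel upper half plane. -/
lemma act_mem_H2 {M : Matrix (Fin 4) (Fin 4) ℝ} (hM : Mᵀ * J4 * M = J4)
    {Ω : Matrix (Fin 2) (Fin 2) ℂ} (hΩ : Ω ∈ H2) : act M Ω ∈ H2 := by
  obtain ⟨hA, hB, hC, hD⟩ := blk_conjTranspose M
  have hZ := isUnit_det_denom hM hΩ
  have keyT := denom_transpose_mul_num hM Ω Ωᵀ
  have keyH := denom_transpose_mul_num hM Ω Ωᴴ
  rw [← Matrix.transpose_mul, ← Matrix.transpose_mul, ← Matrix.transpose_add,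
    ← Matrix.transpose_add, hΩ.1, sub_self, sub_eq_zero] at keyT
  rw [← hA, ← hB, ← hC, ← hD, ← Matrix.conjTranspose_mul, ← Matrix.conjTranspose_mul,
    ← Matrix.conjTranspose_add, ← Matrix.conjTranspose_add, sub_conjTranspose_of_symm hΩ.1] at keyH
  have hW : act M Ω * (blkC M * Ω + blkD M) = blkA M * Ω + blkB M :=
    Matrix.nonsing_inv_mul_cancel_right _ _ hZ
  generalize act M Ω = W at *
  generalize blkC M * Ω + blkD M = Z at *
  rw [← hW] at keyT keyH
  have hZu : IsUnit Z := (Matrix.isUnit_iff_isUnit_det _).mpr hZ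
  have hsymm : Wᵀ = W := by
    rw [Matrix.transpose_mul, ← mul_assoc] at keyT
    have := hZu.mul_right_cancel keyT
    exact (((Matrix.isUnit_transpose _).mpr hZu).mul_left_cancel this).symm
  refine ⟨hsymm, ?_⟩
  change (imPart W).PosDef
  apply posDef_of_map_ofReal
  have hconj : Zᴴ * (imPart W).map ((↑) : ℝ → ℂ) * Z = (imPart Ω).map ((↑) : ℝ → ℂ) := by
    have h2I : (2 * I : ℂ) ≠ 0 := by simp
    apply smul_right_injective _ h2I
    change (2 * I) • _ = (2 * I) • _
    rw [← keyH, ← Matrix.smul_mul, ← Matrix.mul_smul, ← sub_conjTranspose_of_symm hsymm,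
      Matrix.conjTranspose_mul]
    noncomm_ring
  exact (Matrix.IsUnit.posDef_star_left_conjugate_iff hZu).mp
    (by rw [Matrix.star_eq_conjTranspose, hconj]; exact posDef_map_ofReal hΩ.2)

/-- If `M` sends `Ĥ₂` to itself, then the columns of `[Ω; 1]` are orthogonal for the
alternating form `Mᵀ J₄ Q M`. -/
lemma denom_swap_num {M : Matrix (Fin 4) (Fin 4) ℝ} {Ω : Matrix (Fin 2) (Fin 2) ℂ}
    (h : act M Ω ∈ HHat2) :
    (blkC M * Ω + blkD M)ᵀ * swapC * (blkA M * Ω + blkB M)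
      = (blkA M * Ω + blkB M)ᵀ * swapC * (blkC M * Ω + blkD M) := by
  obtain ⟨⟨hsymm, hpos⟩, hq⟩ := h
  rw [act_QM_eq_iff] at hq
  have hZ : IsUnit (blkC M * Ω + blkD M).det := by
    by_contra hZ
    have h0 : act M Ω = 0 := by
      rw [act, Matrix.nonsing_inv_apply_not_isUnit _ hZ, mul_zero]
    have := hpos.diag_pos (i := 0)
    simp [h0] at this
  have hW : act M Ω * (blkC M * Ω + blkD M) = blkA M * Ω + blkB M :=
    Matrix.nonsing_inv_mul_cancel_right _ _ hZ
  rw [← hW, Matrix.transpose_mul, hsymm, mul_assoc, ← mul_assoc swapC, hq]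
  simp only [mul_assoc]

lemma mem_HHat2_of_im {a b : ℝ} (h : |b| < a) :
    (!![a * I, b * I; b * I, a * I] : Matrix (Fin 2) (Fin 2) ℂ) ∈ HHat2 := by
  obtain ⟨h1, h2⟩ := abs_lt.mp h
  refine ⟨⟨?_, ?_⟩, ?_⟩
  · ext i j; fin_cases i <;> fin_cases j <;> simp
  · refine Matrix.PosDef.of_dotProduct_mulVec_pos ?_ ?_
    · ext i j; fin_cases i <;> fin_cases j <;> simp
    · intro x hx
      have hx' : x 0 ≠ 0 ∨ x 1 ≠ 0 := by
        by_contra! hc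
        exact hx (by ext i; fin_cases i <;> simp [hc])
      have hs : 0 < x 0 ^ 2 + x 1 ^ 2 := by
        rcases hx' with h | h <;> positivity
      simp [dotProduct, Matrix.mulVec, Fin.sum_univ_two]
      have e1 := sq_nonneg (x 0 + x 1)
      have e2 := sq_nonneg (x 0 - x 1)
      have : 0 < (a + b) * (x 0 + x 1) ^ 2 + (a - b) * (x 0 - x 1) ^ 2 := by
        by_cases h0 : x 0 + x 1 = 0
        · have : 0 < (x 0 - x 1) ^ 2 := by nlinarith
          have := mul_pos (show 0 < a - b by linarith) this
          rw [h0]; linarith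
        · have h3 : 0 < (x 0 + x 1) ^ 2 := by positivity
          have := mul_pos (show 0 < a + b by linarith) h3
          have := mul_nonneg (show 0 ≤ a - b by linarith) e2
          linarith
      nlinarith
  · rw [act_QM_eq_iff]
    ext i j; fin_cases i <;> fin_cases j <;> simp [swapC]

lemma form_eq_zero {M : Matrix (Fin 4) (Fin 4) ℝ} {a b : ℝ}
    (h : act M !![a * I, b * I; b * I, a * I] ∈ HHat2) :
    let S := Mᵀ * (J4 * QM) * M
    (b ^ 2 - a ^ 2) * S 0 1 + S 2 3 = 0 ∧ a * (S 0 3 - S 1 2) + b * (S 1 3 - S 0 2) = 0 := by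
  have h01 := congrFun (congrFun (denom_swap_num h) 0) 1
  have hS (i j : Fin 4) : (Mᵀ * (J4 * QM) * M) i j =
      M 0 i * M 3 j + M 1 i * M 2 j - M 2 i * M 1 j - M 3 i * M 0 j := by
    simp [Matrix.mul_apply, Fin.sum_univ_four, J4, QM]
    ring
  simp only [hS]
  simp [Matrix.mul_apply, Fin.sum_univ_two, swapC, blkA, blkB, blkC, blkD, Complex.ext_iff] at h01
  obtain ⟨hr, hi⟩ := h01
  constructor
  · linear_combination -hr
  · linear_combination -hi

lemma QM_mul_self : QM * QM = 1 := by
  ext i j; fin_cases i <;> fin_cases j <;> simp [QM, Matrix.mul_apply, Fin.sum_univ_four]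

lemma comm_or_anticomm_of_mem_GHat {M : Matrix (Fin 4) (Fin 4) ℝ} (hM : M ∈ GHat) :
    M * QM = QM * M ∨ M * QM = -(QM * M) := by
  obtain ⟨⟨hdet, hsp⟩, hmap⟩ := hM
  obtain ⟨p1, p2⟩ := form_eq_zero (hmap _ (mem_HHat2_of_im (a := 1) (b := 0) (by norm_num)))
  obtain ⟨q1, -⟩ := form_eq_zero (hmap _ (mem_HHat2_of_im (a := 2) (b := 0) (by norm_num)))
  obtain ⟨-, r2⟩ := form_eq_zero (hmap _ (mem_HHat2_of_im (a := 2) (b := 1) (by norm_num)))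
  have hskew : (Mᵀ * (J4 * QM) * M)ᵀ = -(Mᵀ * (J4 * QM) * M) := by
    have : (J4 * QM)ᵀ = -(J4 * QM) := by
      ext i j; fin_cases i <;> fin_cases j <;> simp [J4, QM]
    rw [Matrix.transpose_mul, Matrix.transpose_mul, this, Matrix.transpose_transpose]
    noncomm_ring
  have hK : Mᵀ * (J4 * QM) * M = J4 * ((Mᵀ * (J4 * QM) * M) 0 2 • (1 : Matrix (Fin 4) (Fin 4) ℝ)
      + (Mᵀ * (J4 * QM) * M) 0 3 • QM) := by
    generalize Mᵀ * (J4 * QM) * M = S at *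
    have hsk (i j : Fin 4) : S j i = - S i j := congrFun (congrFun hskew i) j
    have d0 := hsk 0 0
    have d1 := hsk 1 1
    have d2 := hsk 2 2
    have d3 := hsk 3 3
    ext i j
    fin_cases i <;> fin_cases j <;>
      simp [J4, QM, Matrix.mul_apply, Fin.sum_univ_four] <;>
      linarith [hsk 0 1, hsk 0 2, hsk 0 3, hsk 1 2, hsk 1 3, hsk 2 3]
  generalize (Mᵀ * (J4 * QM) * M) 0 2 = α at hK
  generalize (Mᵀ * (J4 * QM) * M) 0 3 = β at hK
  have hMu : IsUnit M := (Matrix.isUnit_iff_isUnit_det _).mpr hdet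
  have hJu : IsUnit J4 := by
    refine IsUnit.of_mul_eq_one (-J4) ?_
    ext i j; fin_cases i <;> fin_cases j <;> simp [J4, Matrix.mul_apply, Fin.sum_univ_four]
  have hQM : QM * M = M * (α • 1 + β • QM) := by
    apply (((Matrix.isUnit_transpose _).mpr hMu).mul hJu).mul_left_cancel
    rw [← mul_assoc _ M, hsp, ← hK]
    simp only [mul_assoc]
  have hsq : (α • 1 + β • QM) * (α • 1 + β • QM) = 1 := by
    apply hMu.mul_left_cancel
    rw [← mul_assoc, ← hQM, mul_assoc, ← hQM, ← mul_assoc, QM_mul_self, one_mul, mul_one]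
  have s0 := congrFun (congrFun hsq 0) 0
  have s1 := congrFun (congrFun hsq 0) 1
  simp [QM, Matrix.mul_apply, Fin.sum_univ_four] at s0 s1
  have hαβ : α * β = 0 := by linarith
  rcases mul_eq_zero.mp hαβ with h | h
  · subst h
    have : (β - 1) * (β + 1) = 0 := by linarith
    rcases mul_eq_zero.mp this with h | h
    · left
      rw [hQM, sub_eq_zero.mp h]; simp
    · right
      rw [hQM, eq_neg_of_add_eq_zero_left h]; simp
  · subst h
    exfalso
    have hq : QM = α • 1 := by
      apply hMu.mul_right_cancel
      rw [hQM]; simp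
    have := congrFun (congrFun hq 0) 1
    simp [QM] at this

lemma blk_swap_of_mul_QM {M : Matrix (Fin 4) (Fin 4) ℝ} {ε : ℝ}
    (h : M * QM = ε • (QM * M)) :
    blkA M * swapC = (ε : ℂ) • (swapC * blkA M) ∧ blkB M * swapC = (ε : ℂ) • (swapC * blkB M) ∧
    blkC M * swapC = (ε : ℂ) • (swapC * blkC M) ∧ blkD M * swapC = (ε : ℂ) • (swapC * blkD M) := by
  have hij (i j : Fin 4) : (∑ k, M i k * QM k j : ℂ) = ε * ∑ k, (QM i k * M k j : ℂ) := by
    have := congrArg ((↑) : ℝ → ℂ) (congrFun (congrFun h i) j)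
    simpa only [Matrix.smul_apply, Matrix.mul_apply, smul_eq_mul, Complex.ofReal_mul,
      Complex.ofReal_sum] using this
  simp only [Fin.sum_univ_four] at hij
  refine ⟨?_, ?_, ?_, ?_⟩ <;> ext i j <;>
    rw [Matrix.smul_apply, Matrix.mul_apply, Matrix.mul_apply, Fin.sum_univ_two, Fin.sum_univ_two]
  · have := hij (Fin.castAdd 2 i) (Fin.castAdd 2 j)
    fin_cases i <;> fin_cases j <;>
      simpa [blkA, swapC, QM] using this
  · have := hij (Fin.castAdd 2 i) (Fin.natAdd 2 j)
    fin_cases i <;> fin_cases j <;>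
      simpa [blkB, swapC, QM] using this
  · have := hij (Fin.natAdd 2 i) (Fin.castAdd 2 j)
    fin_cases i <;> fin_cases j <;>
      simpa [blkC, swapC, QM] using this
  · have := hij (Fin.natAdd 2 i) (Fin.natAdd 2 j)
    fin_cases i <;> fin_cases j <;>
      simpa [blkD, swapC, QM] using this

lemma mem_GHat_of_mul_QM {M : Matrix (Fin 4) (Fin 4) ℝ} (hM : M ∈ Sp4) {ε : ℝ} (hε : ε ≠ 0)
    (h : M * QM = ε • (QM * M)) : M ∈ GHat := by
  refine ⟨hM, fun Ω hΩ => ⟨act_mem_H2 hM.2 hΩ.1, ?_⟩⟩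
  obtain ⟨hA, hB, hC, hD⟩ := blk_swap_of_mul_QM h
  have hq := (act_QM_eq_iff Ω).mp hΩ.2
  have hZ := isUnit_det_denom hM.2 hΩ.1
  have hX : (blkA M * Ω + blkB M) * swapC = (ε : ℂ) • (swapC * (blkA M * Ω + blkB M)) := by
    rw [add_mul, mul_assoc, ← hq, ← mul_assoc, hA, hB, mul_add, smul_add, Matrix.smul_mul,
      mul_assoc]
  have hY : (blkC M * Ω + blkD M) * swapC = (ε : ℂ) • (swapC * (blkC M * Ω + blkD M)) := by
    rw [add_mul, mul_assoc, ← hq, ← mul_assoc, hC, hD, mul_add, smul_add, Matrix.smul_mul,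
      mul_assoc]
  have hW : act M Ω * (blkC M * Ω + blkD M) = blkA M * Ω + blkB M :=
    Matrix.nonsing_inv_mul_cancel_right _ _ hZ
  rw [act_QM_eq_iff]
  generalize act M Ω = W at *
  generalize blkC M * Ω + blkD M = Z at *
  apply ((Matrix.isUnit_iff_isUnit_det _).mpr hZ).mul_right_cancel
  apply smul_right_injective _ (Complex.ofReal_ne_zero.mpr hε)
  change (ε : ℂ) • _ = (ε : ℂ) • _
  rw [mul_assoc, hW, ← hX, mul_assoc, ← Matrix.mul_smul, ← hY, ← mul_assoc, hW]

/-- `Ĝ = {M ∈ Sp(4,ℝ) | MQ = QM or MQ = -QM}`. -/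
theorem statement1 :
    GHat = {M | M ∈ Sp4 ∧ (M * QM = QM * M ∨ M * QM = -(QM * M))} := by
  ext M
  constructor
  · exact fun h => ⟨h.1, comm_or_anticomm_of_mem_GHat h⟩
  · rintro ⟨hM, h | h⟩
    · exact mem_GHat_of_mul_QM hM one_ne_zero (by rw [one_smul, h])
    · exact mem_GHat_of_mul_QM hM (neg_ne_zero.mpr one_ne_zero) (by rw [neg_one_smul, h])

end
end

section
/- The group $\widehat{G}$ acts transitively on $\widehat{\mathbb{H}}_2$: for any $\Omega_1, \Omega_2 \in \widehat{\mathbb{H}}_2$ there exists $M \in Sp(4,\mathbb{R})$ with $MQ = QM$ or $MQ = -QM$ such that $M\langle\Omega_1\rangle = \Omega_2$. -/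
open Matrix Complex

noncomputable section

/-- Points of `Ĥ₂` are the symmetric matrices `[[x, y], [y, x]]` for which both eigenvalues
`x + y` and `x - y` lie in the upper half plane. -/
theorem exists_eq_of_mem_HHat2 {Ω : Matrix (Fin 2) (Fin 2) ℂ} (h : Ω ∈ HHat2) :
    ∃ x y : ℂ, Ω = !![x, y; y, x] ∧ 0 < (x + y).im ∧ 0 < (x - y).im := by
  obtain ⟨⟨hsymm, hpos⟩, hact⟩ := h
  have h10 : Ω 1 0 = Ω 0 1 := congrFun (congrFun hsymm 0) 1
  have hA : blkA QM = !![0, 1; 1, 0] := by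
    ext i j; fin_cases i <;> fin_cases j <;> simp [blkA, QM]
  have hB : blkB QM = 0 := by
    ext i j; fin_cases i <;> fin_cases j <;> simp [blkB, QM]
  have hC : blkC QM = 0 := by
    ext i j; fin_cases i <;> fin_cases j <;> simp [blkC, QM]
  have hD : blkD QM = !![0, 1; 1, 0] := by
    ext i j; fin_cases i <;> fin_cases j <;> simp [blkD, QM]
  have hinv : (!![0, 1; 1, 0] : Matrix (Fin 2) (Fin 2) ℂ)⁻¹ = !![0, 1; 1, 0] :=
    inv_eq_right_inv (by simp [one_fin_two])
  have h11 : Ω 1 1 = Ω 0 0 := by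
    rw [act, hA, hB, hC, hD, zero_mul, zero_add, add_zero, hinv] at hact
    simpa [vecMul, dotProduct, Matrix.mul_apply, Fin.sum_univ_two] using congrFun (congrFun hact 0) 0
  have hquad (c : ℝ) : 0 < (Ω 0 0).im + c * (Ω 0 1).im + c * ((Ω 0 1).im + c * (Ω 0 0).im) := by
    have := hpos.dotProduct_mulVec_pos (x := ![1, c])
      (fun h0 => one_ne_zero (congrFun h0 0))
    simp [dotProduct, mulVec, Fin.sum_univ_two, h10, h11] at this
    linarith
  refine ⟨Ω 0 0, Ω 0 1, ?_, ?_, ?_⟩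
  · rw [eta_fin_two Ω, h10, h11]; simp
  · rw [add_im]; linarith [hquad 1]
  · rw [sub_im]; linarith [hquad (-1)]

/-- Any point of the upper half plane is carried to any other one by a real affine map
`τ ↦ s² τ + b` with `s` invertible. -/
theorem exists_affine_eq {τ τ' : ℂ} (h : 0 < τ.im) (h' : 0 < τ'.im) :
    ∃ s u b : ℝ, u * s = 1 ∧ (s : ℂ) ^ 2 * τ + b = τ' := by
  have hr : 0 < τ'.im / τ.im := div_pos h' h
  refine ⟨√(τ'.im / τ.im), (√(τ'.im / τ.im))⁻¹, τ'.re - τ'.im / τ.im * τ.re,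
    inv_mul_cancel₀ (Real.sqrt_pos.2 hr).ne', ?_⟩
  rw [← ofReal_pow, Real.sq_sqrt hr.le]
  apply Complex.ext
  · simp only [add_re, re_ofReal_mul, ofReal_re]; ring
  · simp only [add_im, im_ofReal_mul, ofReal_im]; field_simp; ring

/-- The block matrix `[[A, B], [0, D]]` whose blocks `A`, `B`, `D` are `[[a, a'], [a', a]]`,
`[[b, b'], [b', b]]`, `[[d, d'], [d', d]]`. -/
def affineMatrix (a a' b b' d d' : ℝ) : Matrix (Fin 4) (Fin 4) ℝ :=
  !![a, a', b, b'; a', a, b', b; 0, 0, d, d'; 0, 0, d', d]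

theorem affineMatrix_mul_QM (a a' b b' d d' : ℝ) :
    affineMatrix a a' b b' d d' * QM = QM * affineMatrix a a' b b' d d' := by
  ext i j; fin_cases i <;> fin_cases j <;>
    simp [affineMatrix, QM, Matrix.mul_apply, Fin.sum_univ_four]

theorem affineMatrix_mem_Sp4 {a a' b b' d d' : ℝ} (h₁ : a * d + a' * d' = 1)
    (h₂ : a * d' + a' * d = 0) : affineMatrix a a' b b' d d' ∈ Sp4 := by
  have hJ : (affineMatrix a a' b b' d d')ᵀ * J4 * affineMatrix a a' b b' d d' = J4 := by
    ext i j; fin_cases i <;> fin_cases j <;>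
      simp [affineMatrix, J4, Matrix.mul_apply, Fin.sum_univ_four] <;> linarith
  have hdet : J4.det = 1 := by
    simp [J4, det_succ_row_zero, Fin.sum_univ_succ, Fin.succAbove]
  refine ⟨?_, hJ⟩
  have h := congrArg det hJ
  rw [det_mul, det_mul, hdet] at h
  exact IsUnit.of_mul_eq_one_right _ h

theorem act_affineMatrix {a a' d d' : ℝ} (b b' : ℝ) (x y : ℂ) (h₁ : a * d + a' * d' = 1)
    (h₂ : a * d' + a' * d = 0) :
    act (affineMatrix a a' b b' d d') !![x, y; y, x] =
      (!![(a : ℂ), a'; a', a] * !![x, y; y, x] + !![(b : ℂ), b'; b', b]) *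
        !![(a : ℂ), a'; a', a] := by
  have hA : blkA (affineMatrix a a' b b' d d') = !![(a : ℂ), a'; a', a] := by
    ext i j; fin_cases i <;> fin_cases j <;> simp [blkA, affineMatrix]
  have hB : blkB (affineMatrix a a' b b' d d') = !![(b : ℂ), b'; b', b] := by
    ext i j; fin_cases i <;> fin_cases j <;> simp [blkB, affineMatrix]
  have hC : blkC (affineMatrix a a' b b' d d') = 0 := by
    ext i j; fin_cases i <;> fin_cases j <;> simp [blkC, affineMatrix]
  have hD : blkD (affineMatrix a a' b b' d d') = !![(d : ℂ), d'; d', d] := by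
    ext i j; fin_cases i <;> fin_cases j <;> simp [blkD, affineMatrix]
  have hinv : (!![(d : ℂ), d'; d', d])⁻¹ = !![(a : ℂ), a'; a', a] := by
    have h₁' : (a : ℂ) * d + a' * d' = 1 := mod_cast h₁
    have h₂' : (a : ℂ) * d' + a' * d = 0 := mod_cast h₂
    refine inv_eq_right_inv ?_
    rw [one_fin_two, mul_fin_two]
    ext i j; fin_cases i <;> fin_cases j <;> simp
    · linear_combination h₁'
    · linear_combination h₂'
    · linear_combination h₂'
    · linear_combination h₁'
  rw [act, hA, hB, hC, hD, zero_mul, zero_add, hinv]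

/-- `Ĝ = {M ∈ Sp(4,ℝ) | MQ = ±QM}` acts transitively on `Ĥ₂`. -/
theorem statement6 :
    ∀ Ω₁ ∈ HHat2, ∀ Ω₂ ∈ HHat2,
      ∃ M ∈ Sp4, (M * QM = QM * M ∨ M * QM = -(QM * M)) ∧ act M Ω₁ = Ω₂ := by
  intro Ω₁ hΩ₁ Ω₂ hΩ₂
  obtain ⟨x, y, rfl, hadd, hsub⟩ := exists_eq_of_mem_HHat2 hΩ₁
  obtain ⟨x', y', rfl, hadd', hsub'⟩ := exists_eq_of_mem_HHat2 hΩ₂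
  obtain ⟨s, u, m, hus, hm⟩ := exists_affine_eq hadd hadd'
  obtain ⟨t, v, n, hvt, hn⟩ := exists_affine_eq hsub hsub'
  have h₁ : (s + t) / 2 * ((u + v) / 2) + (s - t) / 2 * ((u - v) / 2) = 1 := by
    linear_combination hus / 2 + hvt / 2
  have h₂ : (s + t) / 2 * ((u - v) / 2) + (s - t) / 2 * ((u + v) / 2) = 0 := by
    linear_combination hus / 2 - hvt / 2
  refine ⟨affineMatrix ((s + t) / 2) ((s - t) / 2) ((m * u + n * v) / 2) ((m * u - n * v) / 2)
    ((u + v) / 2) ((u - v) / 2), affineMatrix_mem_Sp4 h₁ h₂, .inl (affineMatrix_mul_QM ..), ?_⟩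
  have hus' : (u : ℂ) * s = 1 := mod_cast hus
  have hvt' : (v : ℂ) * t = 1 := mod_cast hvt
  rw [act_affineMatrix _ _ _ _ h₁ h₂]
  ext i j; fin_cases i <;> fin_cases j <;> simp
  · linear_combination (hm + hn + m * hus' + n * hvt') / 2
  · linear_combination (hm - hn + m * hus' - n * hvt') / 2
  · linear_combination (hm - hn + m * hus' - n * hvt') / 2
  · linear_combination (hm + hn + m * hus' + n * hvt') / 2

end
end

section
/- The group $\widehat{G}_*$ acts transitively on $\widehat{\mathbb{D}}_2$ by $h\langle W\rangle = (\alpha W + \beta)(\overline{\beta}W + \overline{\alpha})^{-1}$ for $h = \begin{pmatrix} \alpha & \beta \\ \overline{\beta} & \overline{\alpha} \end{pmatrix} \in \widehat{G}_*$: for any $W_1, W_2 \in \widehat{\mathbb{D}}_2$ there exists $h \in \widehat{G}_*$ with $h\langle W_1\rangle = W_2$. -/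
open Matrix Complex
open scoped ComplexOrder

noncomputable section

/-- Assemble a 4×4 complex matrix from four 2×2 blocks. -/
def fromB (a b c d : Matrix (Fin 2) (Fin 2) ℂ) : Matrix (Fin 4) (Fin 4) ℂ :=
  Matrix.reindex finSumFinEquiv finSumFinEquiv (Matrix.fromBlocks a b c d)

/-- Entrywise complex conjugate of a matrix. -/
def cj (A : Matrix (Fin 2) (Fin 2) ℂ) : Matrix (Fin 2) (Fin 2) ℂ :=
  A.map (starRingEnd ℂ)

/-- Complexification of `Q`. -/
def QC : Matrix (Fin 4) (Fin 4) ℂ := QM.map Complex.ofReal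

/-- The bounded domain `D₂ = {W | W = ᵗW, I₂ - W W̄ > 0}`. -/
def D2 : Set (Matrix (Fin 2) (Fin 2) ℂ) :=
  {W | Wᵀ = W ∧ ((1 : Matrix (Fin 2) (Fin 2) ℂ) - W * W.map (starRingEnd ℂ)).PosDef}

/-- Complexification of `q`. -/
def qC : Matrix (Fin 2) (Fin 2) ℂ := !![0,1; 1,0]

/-- `D̂₂ = {W ∈ D₂ | qW = Wq}`. -/
def DHat2 : Set (Matrix (Fin 2) (Fin 2) ℂ) :=
  {W | W ∈ D2 ∧ qC * W = W * qC}

/-- `SU(1,1)` acts transitively on the unit disc by Möbius transformations. -/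
theorem exists_moebius_disc {u v : ℂ} (hu : normSq u < 1) (hv : normSq v < 1) :
    ∃ a b : ℂ, a * starRingEnd ℂ a - b * starRingEnd ℂ b = 1 ∧
      a * u + b = v * (starRingEnd ℂ b * u + starRingEnd ℂ a) ∧
      starRingEnd ℂ b * u + starRingEnd ℂ a ≠ 0 := by
  have hpos : 0 < (1 - normSq u) * (1 - normSq v) := mul_pos (by linarith) (by linarith)
  obtain ⟨r, hr⟩ : ∃ r : ℝ, r ^ 2 * ((1 - normSq u) * (1 - normSq v)) = 1 :=
    ⟨(√((1 - normSq u) * (1 - normSq v)))⁻¹, by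
      rw [inv_pow, Real.sq_sqrt hpos.le, inv_mul_cancel₀ hpos.ne']⟩
  have hr0 : r ≠ 0 := by
    rintro rfl
    simp at hr
  have hrC : (r : ℂ) ^ 2 * ((1 - u * starRingEnd ℂ u) * (1 - v * starRingEnd ℂ v)) = 1 := by
    rw [mul_conj, mul_conj]
    exact_mod_cast hr
  have hden : starRingEnd ℂ (r * (v - u)) * u + starRingEnd ℂ (r * (1 - v * starRingEnd ℂ u))
      = r * (1 - u * starRingEnd ℂ u) := by
    simp only [map_mul, map_sub, map_one, conj_ofReal, conj_conj]
    ring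
  refine ⟨r * (1 - v * starRingEnd ℂ u), r * (v - u), ?_, ?_, ?_⟩
  · simp only [map_mul, map_sub, map_one, conj_ofReal, conj_conj]
    linear_combination hrC
  · rw [hden]
    ring
  · rw [hden]
    intro h
    rw [show (r : ℂ) ^ 2 * ((1 - u * starRingEnd ℂ u) * (1 - v * starRingEnd ℂ v))
      = (r * (1 - u * starRingEnd ℂ u)) * (r * (1 - v * starRingEnd ℂ v)) by ring, h] at hrC
    simp at hrC

/-- The symmetric circulant matrix with eigenvalue `s` on `(1, 1)` and `t` on `(1, -1)`. -/
def circ (s t : ℂ) : Matrix (Fin 2) (Fin 2) ℂ :=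
  !![(s + t) / 2, (s - t) / 2; (s - t) / 2, (s + t) / 2]

theorem circ_mul (s t s' t' : ℂ) : circ s t * circ s' t' = circ (s * s') (t * t') := by
  ext i j
  fin_cases i <;> fin_cases j <;> simp [circ, Matrix.mul_apply] <;> ring

theorem circ_add (s t s' t' : ℂ) : circ s t + circ s' t' = circ (s + s') (t + t') := by
  ext i j
  fin_cases i <;> fin_cases j <;> simp [circ] <;> ring

theorem circ_sub (s t s' t' : ℂ) : circ s t - circ s' t' = circ (s - s') (t - t') := by
  ext i j
  fin_cases i <;> fin_cases j <;> simp [circ] <;> ring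

theorem circ_one : circ 1 1 = 1 := by
  ext i j
  fin_cases i <;> fin_cases j <;> simp [circ]

theorem circ_transpose (s t : ℂ) : (circ s t)ᵀ = circ s t := by
  ext i j
  fin_cases i <;> fin_cases j <;> simp [circ]

theorem cj_circ (s t : ℂ) : cj (circ s t) = circ (starRingEnd ℂ s) (starRingEnd ℂ t) := by
  ext i j
  fin_cases i <;> fin_cases j <;> simp [circ, cj, map_ofNat]

theorem det_circ (s t : ℂ) : (circ s t).det = s * t := by
  rw [circ, det_fin_two_of]
  ring

theorem qC_eq_circ : qC = circ 1 (-1) := by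
  ext i j
  fin_cases i <;> fin_cases j <;> simp [circ, qC]

theorem QC_eq_fromB : QC = fromB qC 0 0 qC := by
  ext i j
  fin_cases i <;> fin_cases j <;>
    simp [QC, QM, fromB, qC, finSumFinEquiv, Fin.addCases, fromBlocks]

theorem fromB_mul (a b c d a' b' c' d' : Matrix (Fin 2) (Fin 2) ℂ) :
    fromB a b c d * fromB a' b' c' d' =
      fromB (a * a' + b * c') (a * b' + b * d') (c * a' + d * c') (c * b' + d * d') := by
  simp only [fromB, reindex_apply, submatrix_mul_equiv, fromBlocks_multiply]

theorem QC_mul_fromB_comm {a b c d : Matrix (Fin 2) (Fin 2) ℂ} (ha : Commute qC a)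
    (hb : Commute qC b) (hc : Commute qC c) (hd : Commute qC d) :
    QC * fromB a b c d = fromB a b c d * QC := by
  simp [QC_eq_fromB, fromB_mul, ha.eq, hb.eq, hc.eq, hd.eq]

theorem commute_qC_circ (s t : ℂ) : Commute qC (circ s t) := by
  rw [qC_eq_circ, Commute, SemiconjBy, circ_mul, circ_mul, mul_comm 1, mul_comm (-1)]

theorem normSq_lt_one_of_posDef_circ {s t : ℂ}
    (h : ((1 : Matrix (Fin 2) (Fin 2) ℂ) - circ s t * cj (circ s t)).PosDef) :
    normSq s < 1 ∧ normSq t < 1 := by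
  rw [cj_circ, circ_mul, ← circ_one, circ_sub, mul_conj, mul_conj] at h
  constructor
  · have := h.re_dotProduct_pos (x := ![1, 1]) (by simp)
    simp [circ, dotProduct, mulVec, Fin.sum_univ_two] at this
    linarith
  · have := h.re_dotProduct_pos (x := ![1, -1]) (by simp)
    simp [circ, dotProduct, mulVec, Fin.sum_univ_two] at this
    linarith

/-- Elements of `D̂₂` are pairs of points of the unit disc. -/
theorem exists_circ_of_mem_DHat2 {W : Matrix (Fin 2) (Fin 2) ℂ} (hW : W ∈ DHat2) :
    ∃ s t : ℂ, W = circ s t ∧ normSq s < 1 ∧ normSq t < 1 := by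
  obtain ⟨⟨hsymm, hpos⟩, hq⟩ := hW
  have hcomm := congrFun (congrFun hq 0) 1
  have hsym := congrFun (congrFun hsymm 0) 1
  simp [qC, Matrix.mul_apply] at hcomm hsym
  have hc : W = circ (W 0 0 + W 0 1) (W 0 0 - W 0 1) := by
    ext i j
    fin_cases i <;> fin_cases j <;> simp [circ, hcomm, hsym]
  refine ⟨_, _, hc, normSq_lt_one_of_posDef_circ ?_⟩
  rw [← hc]
  exact hpos

/-- `Ĝ_*` acts transitively on `D̂₂` by
`h⟨W⟩ = (αW + β)(β̄W + ᾱ)⁻¹`. -/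
theorem statement7 :
    ∀ W₁ ∈ DHat2, ∀ W₂ ∈ DHat2,
      ∃ α β : Matrix (Fin 2) (Fin 2) ℂ,
        α * (cj α)ᵀ - β * (cj β)ᵀ = 1 ∧
        α * (cj β)ᵀ = cj β * αᵀ ∧
        (QC * fromB α β (cj β) (cj α) = fromB α β (cj β) (cj α) * QC ∨
         QC * fromB α β (cj β) (cj α) = -(fromB α β (cj β) (cj α) * QC)) ∧
        (α * W₁ + β) * (cj β * W₁ + cj α)⁻¹ = W₂ := by
  intro W₁ hW₁ W₂ hW₂
  obtain ⟨u, u', rfl, hu, hu'⟩ := exists_circ_of_mem_DHat2 hW₁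
  obtain ⟨v, v', rfl, hv, hv'⟩ := exists_circ_of_mem_DHat2 hW₂
  obtain ⟨a, b, hab, hact, hne⟩ := exists_moebius_disc hu hv
  obtain ⟨a', b', hab', hact', hne'⟩ := exists_moebius_disc hu' hv'
  refine ⟨circ a a', circ b b', ?_, ?_, Or.inl ?_, ?_⟩
  · rw [cj_circ, cj_circ, circ_transpose, circ_transpose, circ_mul, circ_mul, circ_sub, hab, hab',
      circ_one]
  · rw [cj_circ, circ_transpose, circ_transpose, circ_mul, circ_mul, mul_comm a, mul_comm a']
  · rw [cj_circ, cj_circ]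
    exact QC_mul_fromB_comm (commute_qC_circ _ _) (commute_qC_circ _ _) (commute_qC_circ _ _)
      (commute_qC_circ _ _)
  · rw [cj_circ, cj_circ, circ_mul, circ_mul, circ_add, circ_add, hact, hact', ← circ_mul]
    refine mul_nonsing_inv_cancel_right _ _ ?_
    rw [det_circ]
    exact (mul_ne_zero hne hne').isUnit

end
end
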